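/- arXiv:0710.4268 — 4 statements merged into one kernel-verified Lean document; each statement's English description precedes it below -/
import Mathlib

section
/- Let p be a prime and n a natural number, and set μ' = p^n·(2p − 1)/p^2 ∈ ℚ. Then the variance of the number of zeros of the pointwise product over all pairs (φ, ψ) of functions (Fin n → ZMod p) → ZMod p satisfies (1 / p^(2·p^n)) · ∑_{(φ,ψ)} ((Z(φ·ψ) : ℚ) − μ')^2 = p^n · ((2p − 1)/p^2) · ((p − 1)^2/p^2); in particular this variance is strictly less than μ' (i.e. the standard deviation σ' satisfies σ' < √μ'). -/
/-- The second moment of a sum of independent centred variables, over uniformly distributed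
functions `α → β`. -/
theorem Fintype.sum_sum_comp_sq_of_sum_eq_zero {α β R : Type*} [Fintype α] [DecidableEq α]
    [Fintype β] [CommRing R] (g : β → R) (hg : ∑ b, g b = 0) :
    ∑ h : α → β, (∑ x, g (h x)) ^ 2 =
      Fintype.card α * ((Fintype.card β : R) ^ (Fintype.card α - 1) * ∑ b, g b ^ 2) := by
  have key : ∀ x y : α, ∑ h : α → β, g (h x) * g (h y) =
      if x = y then (Fintype.card β : R) ^ (Fintype.card α - 1) * ∑ b, g b ^ 2 else 0 := by
    intro x y
    have h1 : ∀ h : α → β, g (h x) * g (h y) =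
        ∏ i, (if i = x then g (h i) else 1) * (if i = y then g (h i) else 1) := by
      intro h
      rw [Finset.prod_mul_distrib]
      simp
    simp_rw [h1]
    rw [← Fintype.prod_sum (fun (i : α) (b : β) =>
      (if i = x then g b else 1) * (if i = y then g b else 1))]
    split_ifs with hxy
    · subst hxy
      rw [← Finset.prod_erase_mul _ _ (Finset.mem_univ x)]
      have h2 : ∀ i ∈ Finset.univ.erase x,
          ∑ b, (if i = x then g b else 1) * (if i = x then g b else 1) =
            (Fintype.card β : R) := by
        intro i hi
        simp [Finset.ne_of_mem_erase hi]
      rw [Finset.prod_congr rfl h2]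
      simp [Finset.card_erase_of_mem, sq]
    · apply Finset.prod_eq_zero (Finset.mem_univ x)
      simp [hxy, hg]
  simp_rw [sq (∑ x, g _), Finset.sum_mul_sum]
  rw [Finset.sum_comm]
  simp_rw [Finset.sum_comm (s := (Finset.univ : Finset (α → β))), key]
  simp

theorem Fintype.sum_ite_mul_eq_zero (F R : Type*) [Field F] [Fintype F] [DecidableEq F]
    [CommRing R] :
    ∑ c : F × F, (if c.1 * c.2 = 0 then (1 : R) else 0) = 2 * Fintype.card F - 1 := by
  rw [Fintype.sum_prod_type, ← Finset.sum_erase_add _ _ (Finset.mem_univ (0 : F))]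
  have h : ∀ a ∈ Finset.univ.erase (0 : F),
      ∑ b : F, (if a * b = 0 then (1 : R) else 0) = 1 := by
    intro a ha
    simp [Finset.ne_of_mem_erase ha]
  rw [Finset.sum_congr rfl h]
  simp only [Finset.sum_const, Finset.card_erase_of_mem (Finset.mem_univ _), Finset.card_univ,
    zero_mul, if_true, nsmul_eq_mul, mul_one]
  rw [Nat.cast_sub Fintype.card_pos]
  push_cast
  ring

/-- The variance of the number of zeros of the pointwise product over all pairs `(φ, ψ)`
of functions `𝔽_p^n → 𝔽_p` equals `p^n · ((2p-1)/p^2) · ((p-1)^2/p^2)`, and this variance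
is strictly less than `μ' = p^n · (2p-1)/p^2`. -/
theorem variance_of_zero_counts_of_products (p : ℕ) [Fact p.Prime] (n : ℕ) (μ' : ℚ)
    (hμ' : μ' = (p : ℚ) ^ n * (2 * p - 1) / p ^ 2) :
    (1 / (p : ℚ) ^ (2 * p ^ n)) *
        ∑ φ : (Fin n → ZMod p) → ZMod p, ∑ ψ : (Fin n → ZMod p) → ZMod p,
          (((Finset.univ.filter (fun x : Fin n → ZMod p => φ x * ψ x = 0)).card : ℚ) - μ') ^ 2
      = (p : ℚ) ^ n * ((2 * p - 1) / p ^ 2) * (((p : ℚ) - 1) ^ 2 / p ^ 2) ∧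
    (p : ℚ) ^ n * ((2 * p - 1) / p ^ 2) * (((p : ℚ) - 1) ^ 2 / p ^ 2) < μ' := by
  have hp1 : (1 : ℚ) < p := by exact_mod_cast (Fact.out : p.Prime).one_lt
  have hp0 : (p : ℚ) ≠ 0 := by positivity
  have hq : (0 : ℚ) < (2 * p - 1) / p ^ 2 := div_pos (by linarith) (by positivity)
  constructor
  · set q : ℚ := (2 * p - 1) / p ^ 2 with hq_def
    let g : ZMod p × ZMod p → ℚ := fun c => (if c.1 * c.2 = 0 then 1 else 0) - q
    have hcount := Fintype.sum_ite_mul_eq_zero (ZMod p) ℚ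
    rw [ZMod.card] at hcount
    have hpq : (p : ℚ) ^ 2 * q = 2 * p - 1 := by
      rw [hq_def]; field_simp
    have hg : ∑ c, g c = 0 := by
      simp only [g, Finset.sum_sub_distrib, hcount, Finset.sum_const, Finset.card_univ,
        Fintype.card_prod, ZMod.card, nsmul_eq_mul]
      push_cast
      linarith
    have hg2 : ∑ c, g c ^ 2 = (2 * p - 1) * (1 - q) := by
      have h : ∀ c, g c ^ 2 = (1 - 2 * q) * (if c.1 * c.2 = 0 then 1 else 0) + q ^ 2 := by
        intro c
        simp only [g]
        split_ifs <;> ring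
      simp only [h, Finset.sum_add_distrib, ← Finset.mul_sum, hcount, Finset.sum_const,
        Finset.card_univ, Fintype.card_prod, ZMod.card, nsmul_eq_mul]
      push_cast
      linear_combination q * hpq
    have hsum : ∑ φ : (Fin n → ZMod p) → ZMod p, ∑ ψ : (Fin n → ZMod p) → ZMod p,
          (((Finset.univ.filter (fun x : Fin n → ZMod p => φ x * ψ x = 0)).card : ℚ) - μ') ^ 2
        = ∑ h : (Fin n → ZMod p) → ZMod p × ZMod p, (∑ x, g (h x)) ^ 2 := by
      rw [← Fintype.sum_prod_type', ← (Equiv.arrowProdEquivProdArrow _ _ _).sum_comp]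
      refine Finset.sum_congr rfl fun h _ => ?_
      congr 1
      simp only [g, Finset.sum_sub_distrib, Finset.sum_boole, Finset.sum_const, Finset.card_univ,
        Fintype.card_fun, Fintype.card_fin, ZMod.card, nsmul_eq_mul]
      push_cast
      rw [hμ', mul_div_assoc]
      rfl
    rw [hsum, Fintype.sum_sum_comp_sq_of_sum_eq_zero g hg, hg2]
    obtain ⟨k, hk⟩ : ∃ k, p ^ n = k + 1 :=
      Nat.exists_eq_succ_of_ne_zero (pow_ne_zero _ (Fact.out : p.Prime).ne_zero)
    have hq1 : 1 - q = ((p : ℚ) - 1) ^ 2 / p ^ 2 := by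
      rw [hq_def]; field_simp; ring
    simp only [Fintype.card_fun, Fintype.card_fin, ZMod.card, Fintype.card_prod, ← hq1, hk,
      Nat.add_sub_cancel]
    have hk' : (p : ℚ) ^ n = k + 1 := by exact_mod_cast hk
    rw [hk', ← hpq]
    push_cast
    rw [← sq, ← pow_mul, mul_add, pow_add]
    field_simp
  · have h1 : ((p : ℚ) - 1) ^ 2 / p ^ 2 < 1 := by
      rw [div_lt_one (by positivity)]
      nlinarith
    rw [hμ', mul_div_assoc]
    exact mul_lt_of_lt_one_right (by positivity) h1
end

section
/- Let f ∈ MvPolynomial (Fin n) ℤ be an integer polynomial in n variables, let a, h : Fin n → ℤ, and let m : ℤ be such that m divides h i for every i : Fin n. Then f(a + h) ≡ f(a) + ∑_{i} h i · (∂f/∂x_i)(a) (mod m²), i.e. m² divides eval (a + h) f − eval a f − ∑ i, h i · eval a (pderiv i f). -/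
/-- First-order Taylor expansion for integer polynomials: if `m` divides each coordinate of
the increment `h`, then `f(a + h) ≡ f(a) + ∑ i, h i · (∂f/∂x_i)(a)  (mod m²)`. -/
theorem taylor_mod_m_sq (n : ℕ) (f : MvPolynomial (Fin n) ℤ) (a h : Fin n → ℤ) (m : ℤ)
    (hm : ∀ i, m ∣ h i) :
    m ^ 2 ∣ MvPolynomial.eval (a + h) f - MvPolynomial.eval a f
      - ∑ i, h i * MvPolynomial.eval a (MvPolynomial.pderiv i f) := by
  induction f using MvPolynomial.induction_on with
  | C c => simp
  | add p q hp hq =>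
    refine (dvd_add hp hq).trans (dvd_of_eq ?_)
    simp only [map_add, mul_add, Finset.sum_add_distrib]
    ring
  | mul_X p j hp =>
    have hsum : ∑ i, h i * MvPolynomial.eval a (MvPolynomial.pderiv i (p * MvPolynomial.X j)) =
        (∑ i, h i * MvPolynomial.eval a (MvPolynomial.pderiv i p)) * a j
          + h j * MvPolynomial.eval a p := by
      simp [MvPolynomial.pderiv_X, Pi.single_apply, apply_ite,
        mul_add, Finset.sum_add_distrib, Finset.sum_mul, mul_assoc, mul_comm (a j), add_comm]
    have hdvd : m ∣ ∑ i, h i * MvPolynomial.eval a (MvPolynomial.pderiv i p) :=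
      Finset.dvd_sum fun i _ => (hm i).mul_right _
    have hmul := mul_dvd_mul (hm j) hdvd
    rw [← pow_two] at hmul
    rw [hsum]
    refine (dvd_add (hp.mul_right (a j + h j)) hmul).trans (dvd_of_eq ?_)
    simp only [map_mul, MvPolynomial.eval_X, Pi.add_apply]
    ring
end

section
/- Let p be a prime, k ≥ 1, and n ≥ 1. Let f : Fin n → MvPolynomial (Fin n) ℤ be a system of n integer polynomials in n variables and a : Fin n → ℤ a point with eval a (f i) ≡ 0 (mod p^k) for all i. Let J(a) be the n × n integer matrix with entries J(a)_{i j} = eval a (pderiv j (f i)), and suppose B is an n × n integer matrix such that J(a) · B ≡ 1 (the identity matrix) entrywise mod p^k. Define a' : Fin n → ℤ by a' j = a j − ∑_{i} B_{j i} · eval a (f i) (i.e. a' = a − B · f(a) as column vectors). Then eval a' (f i) ≡ 0 (mod p^(2k)) for all i. -/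
/-- First-order Taylor expansion: if every coordinate of `h` is divisible by `m`, the
linear approximation of `g` at `a` is correct modulo `m ^ 2`. -/
theorem MvPolynomial.sq_dvd_eval_add_sub_linear {σ R : Type*} [Fintype σ] [CommRing R]
    (m : R) (a h : σ → R) (hm : ∀ j, m ∣ h j) (g : MvPolynomial σ R) :
    m ^ 2 ∣ eval (a + h) g - (eval a g + ∑ j, eval a (pderiv j g) * h j) := by
  classical
  induction g using MvPolynomial.induction_on with
  | C r => simp
  | add g₁ g₂ h₁ h₂ =>
    convert dvd_add h₁ h₂ using 1
    simp only [map_add, add_mul, Finset.sum_add_distrib]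
    ring
  | mul_X g i ih =>
    have hsum : ∑ j, eval a (pderiv j (g * X i)) * h j
        = a i * ∑ j, eval a (pderiv j g) * h j + eval a g * h i := by
      simp [Derivation.leibniz, pderiv_X, Pi.single_apply, add_mul, Finset.sum_add_distrib,
        Finset.mul_sum, mul_assoc, apply_ite, add_comm]
    have hquad : m ^ 2 ∣ (∑ j, eval a (pderiv j g) * h j) * h i := by
      rw [sq]
      exact mul_dvd_mul (Finset.dvd_sum fun j _ => (hm j).mul_left _) (hm i)
    rw [hsum]
    convert dvd_add (ih.mul_right (a i + h i)) hquad using 1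
    simp only [map_mul, eval_X, Pi.add_apply]
    ring

/-- One step of p-adic Newton iteration: if `a` solves the system `f` mod `p^k` and `B` is
an inverse of the Jacobian matrix `J(a)` mod `p^k`, then `a' = a - B·f(a)` solves the
system mod `p^(2k)`. -/
theorem newton_step_padic (p : ℕ) (hp : p.Prime) (k n : ℕ) (hk : 1 ≤ k) (hn : 1 ≤ n)
    (f : Fin n → MvPolynomial (Fin n) ℤ) (a : Fin n → ℤ)
    (ha : ∀ i, (p : ℤ) ^ k ∣ MvPolynomial.eval a (f i))
    (B : Matrix (Fin n) (Fin n) ℤ)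
    (hB : ∀ i j, (p : ℤ) ^ k ∣
      (((Matrix.of fun i j => MvPolynomial.eval a (MvPolynomial.pderiv j (f i))) * B) i j
        - (1 : Matrix (Fin n) (Fin n) ℤ) i j))
    (a' : Fin n → ℤ)
    (ha' : ∀ j, a' j = a j - ∑ i, B j i * MvPolynomial.eval a (f i)) :
    ∀ i, (p : ℤ) ^ (2 * k) ∣ MvPolynomial.eval a' (f i) := by
  intro i
  set F : Fin n → ℤ := fun l => MvPolynomial.eval a (f l) with hF
  set J : Matrix (Fin n) (Fin n) ℤ :=
    Matrix.of fun i j => MvPolynomial.eval a (MvPolynomial.pderiv j (f i)) with hJ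
  have hFdvd : ∀ l, (p : ℤ) ^ k ∣ F l := ha
  have hstep : a' = a + -(B.mulVec F) := by
    funext j
    simp [ha' j, Matrix.mulVec, dotProduct, hF, sub_eq_add_neg]
  have hcorr : ∀ j, (p : ℤ) ^ k ∣ (-(B.mulVec F)) j := by
    intro j
    rw [Pi.neg_apply, dvd_neg, Matrix.mulVec, dotProduct]
    exact Finset.dvd_sum fun l _ => (hFdvd l).mul_left _
  have htaylor := MvPolynomial.sq_dvd_eval_add_sub_linear ((p : ℤ) ^ k) a (-(B.mulVec F))
    hcorr (f i)
  have hlin : F i + J.mulVec (-(B.mulVec F)) i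
      = -∑ l, ((J * B) i l - (1 : Matrix (Fin n) (Fin n) ℤ) i l) * F l := by
    have hone : F i = (1 : Matrix (Fin n) (Fin n) ℤ).mulVec F i := by simp
    rw [Matrix.mulVec_neg, Matrix.mulVec_mulVec, hone]
    simp only [Pi.neg_apply, Matrix.mulVec, dotProduct, sub_mul, Finset.sum_sub_distrib]
    ring
  have hlin_dvd : ((p : ℤ) ^ k) ^ 2 ∣ F i + J.mulVec (-(B.mulVec F)) i := by
    rw [hlin, sq]
    exact (Finset.dvd_sum fun l _ => mul_dvd_mul (hB i l) (hFdvd l)).neg_right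
  rw [mul_comm 2 k, pow_mul, hstep]
  exact (dvd_iff_dvd_of_dvd_sub htaylor).2 hlin_dvd
end

section
/- Let m be a positive integer and a an integer. Suppose (r, s) and (r', s') are pairs of integers with s ≠ 0 and s' ≠ 0 such that m divides r − a·s and m divides r' − a·s', and such that 4·r² ≤ m, 4·s² ≤ m, 4·r'² ≤ m, 4·s'² ≤ m (i.e. |r|, |s|, |r'|, |s'| ≤ (1/2)√m). Then r·s' = r'·s; in particular the two pairs represent the same rational number r/s = r'/s'. -/
/-- Uniqueness in rational reconstruction: two fractions `r/s`, `r'/s'` with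
`r ≡ a·s (mod m)`, `r' ≡ a·s' (mod m)` and all of `|r|, |s|, |r'|, |s'| ≤ (1/2)√m`
(expressed as `4·r² ≤ m` etc.) represent the same rational number. -/
theorem rational_reconstruction_unique (m : ℤ) (hm : 0 < m) (a r s r' s' : ℤ)
    (hs : s ≠ 0) (hs' : s' ≠ 0)
    (h1 : m ∣ r - a * s) (h2 : m ∣ r' - a * s')
    (hr : 4 * r ^ 2 ≤ m) (hsb : 4 * s ^ 2 ≤ m)
    (hr' : 4 * r' ^ 2 ≤ m) (hs'b : 4 * s' ^ 2 ≤ m) :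
    r * s' = r' * s := by
  have hdvd : m ∣ r * s' - r' * s := by
    have h := dvd_sub (h1.mul_right s') (h2.mul_right s)
    rwa [show (r - a * s) * s' - (r' - a * s') * s = r * s' - r' * s by ring] at h
  have hlt : |r * s' - r' * s| < m := by
    rw [abs_lt]
    constructor <;>
      linarith [sq_nonneg (r - s'), sq_nonneg (r + s'), sq_nonneg (r' - s), sq_nonneg (r' + s)]
  exact sub_eq_zero.mp (Int.eq_zero_of_abs_lt_dvd hdvd hlt)
end
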